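/- arXiv:math/9910094 — 2 statements merged into one kernel-verified Lean document; each statement's English description precedes it below -/
import Mathlib

section
/- Let n ≥ 1, ℏ ∈ ℝ, and let g^{ij} be polynomial functions on ℝ^n with g^{ij} = g^{ji}. On ℂ[x^1, …, x^n, ξ_1, …, ξ_n] define the operators D = ∂²/∂ξ_i∂x^i and, on the ξ-homogeneous component of degree k, let C_m(E) act as multiplication by the scalar C_m(k + n/2), where C_m(t) = (1/m!) (t+1/2)(t+3/2)⋯(t+m−1/2) / ((2t+m)(2t+m+1)⋯(2t+2m−1)). Let I_ℏ(P)(x, ξ) = P(x, iℏξ), and let σ^{−1} be the normal-ordering map sending a polynomial Σ A^{i_1…i_k}(x) ξ_{i_1}⋯ξ_{i_k} to the differential operator Σ A^{i_1…i_k}(x) ∂_{i_1}⋯∂_{i_k}. Then for the quadratic symbol H = g^{ij} ξ_i ξ_j one has σ^{−1}( Σ_{m=0}^{∞} C_m(E) D^m (I_ℏ H) ) = −ℏ² ( g^{ij} ∂_i ∂_j + (∂_j g^{ij}) ∂_i + ((n+1)/(4(n+2))) (∂_i ∂_j g^{ij}) ), the sum being finite since D^m H = 0 for m ≥ 3. 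-/
set_option maxHeartbeats 1000000

open MvPolynomial Finset

/-- Complex polynomials on `T*ℝⁿ`: variables `Sum.inl i = xⁱ` and `Sum.inr i = ξᵢ`. -/
abbrev SymbC (n : ℕ) := MvPolynomial (Fin n ⊕ Fin n) ℂ

/-- A real polynomial in `x` viewed as a complex polynomial in `(x, ξ)`. -/
noncomputable def liftXC {n : ℕ} (P : MvPolynomial (Fin n) ℝ) : SymbC n :=
  rename Sum.inl (map (algebraMap ℝ ℂ) P)

/-- The divergence operator `D = ∂²/∂ξᵢ∂xⁱ` on symbols. -/
noncomputable def Dop {n : ℕ} (P : SymbC n) : SymbC n :=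
  ∑ i, pderiv (Sum.inr i) (pderiv (Sum.inl i) P)

/-- The rescaling `I_ℏ(P)(x, ξ) = P(x, iℏξ)`. -/
noncomputable def Ihbar {n : ℕ} (ℏ : ℝ) (P : SymbC n) : SymbC n :=
  aeval (Sum.elim (fun i => X (Sum.inl i))
    (fun i => C (Complex.I * (ℏ : ℂ)) * X (Sum.inr i))) P

/-- The coefficients
`C_m(t) = (1/m!)·(t+1/2)(t+3/2)⋯(t+m−1/2)/((2t+m)(2t+m+1)⋯(2t+2m−1))`
of the projectively equivariant quantization map `Q_{1/2;ℏ} = Σ_m C_m(E) D^m`. -/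
noncomputable def Cc (m : ℕ) (t : ℝ) : ℝ :=
  (1 / (m.factorial : ℝ)) * (∏ j ∈ range m, (t + 1 / 2 + j))
    / (∏ j ∈ range m, (2 * t + m + j))

theorem pderiv_inl_liftXC {n : ℕ} (i : Fin n) (P : MvPolynomial (Fin n) ℝ) :
    pderiv (Sum.inl i) (liftXC P) = liftXC (pderiv i P) := by
  unfold liftXC
  rw [pderiv_rename Sum.inl_injective, pderiv_map]

theorem pderiv_inr_liftXC {n : ℕ} (i : Fin n) (P : MvPolynomial (Fin n) ℝ) :
    pderiv (Sum.inr i) (liftXC P) = 0 := by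
  unfold liftXC
  induction P using MvPolynomial.induction_on with
  | C a => simp
  | add p q hp hq => simp [hp, hq]
  | mul_X p k hp => simp [hp, Derivation.leibniz, pderiv_X]

theorem Dop_sum {n : ℕ} {ι : Type} (s : Finset ι) (f : ι → SymbC n) :
    Dop (∑ k ∈ s, f k) = ∑ k ∈ s, Dop (f k) := by
  unfold Dop
  simp only [map_sum]
  rw [Finset.sum_comm]

theorem Dop_add {n : ℕ} (p q : SymbC n) : Dop (p + q) = Dop p + Dop q := by
  unfold Dop
  simp only [map_add, Finset.sum_add_distrib]

theorem Dop_smul {n : ℕ} (c : ℂ) (p : SymbC n) : Dop (c • p) = c • Dop p := by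
  unfold Dop
  simp only [Derivation.map_smul, Finset.smul_sum]

theorem Dop_zero {n : ℕ} : Dop (0 : SymbC n) = 0 := by
  simp [Dop]

theorem Dop_lift {n : ℕ} (a : MvPolynomial (Fin n) ℝ) : Dop (liftXC a) = 0 := by
  simp [Dop, pderiv_inl_liftXC, pderiv_inr_liftXC]

theorem Dop_lift1 {n : ℕ} (a : MvPolynomial (Fin n) ℝ) (i : Fin n) :
    Dop (liftXC a * X (Sum.inr i)) = liftXC (pderiv i a) := by
  simp [Dop, pderiv_inl_liftXC, pderiv_inr_liftXC, Derivation.leibniz, pderiv_X, Pi.single_apply]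

theorem Dop_lift2 {n : ℕ} (a : MvPolynomial (Fin n) ℝ) (i j : Fin n) :
    Dop (liftXC a * X (Sum.inr i) * X (Sum.inr j)) =
      liftXC (pderiv j a) * X (Sum.inr i) + liftXC (pderiv i a) * X (Sum.inr j) := by
  simp [Dop, pderiv_inl_liftXC, pderiv_inr_liftXC, Derivation.leibniz, pderiv_X, Pi.single_apply,
    Finset.sum_add_distrib]
  ring

theorem Ihbar_lift {n : ℕ} (ℏ : ℝ) (a : MvPolynomial (Fin n) ℝ) :
    Ihbar ℏ (liftXC a) = liftXC a := by
  unfold Ihbar liftXC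
  rw [aeval_rename]
  generalize MvPolynomial.map (algebraMap ℝ ℂ) a = q
  induction q using MvPolynomial.induction_on with
  | C a => simp [algebraMap_eq]
  | add p q hp hq => simp only [map_add, hp, hq]
  | mul_X p k hp => rw [map_mul (aeval _), map_mul (rename _), hp, aeval_X, rename_X, Function.comp_apply, Sum.elim_inl]

theorem Ihbar_H {n : ℕ} (ℏ : ℝ) (g : Fin n → Fin n → MvPolynomial (Fin n) ℝ) :
    Ihbar ℏ (∑ i, ∑ j, liftXC (g i j) * X (Sum.inr i) * X (Sum.inr j)) =
      (-(ℏ : ℂ) ^ 2) • ∑ i, ∑ j, liftXC (g i j) * X (Sum.inr i) * X (Sum.inr j) := by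
  have hl := fun i j => Ihbar_lift ℏ (g i j)
  have hI : (-(ℏ : ℂ) ^ 2) = (Complex.I * ℏ) * (Complex.I * ℏ) := by
    linear_combination (-(ℏ : ℂ) ^ 2) * Complex.I_mul_I
  unfold Ihbar at hl ⊢
  simp only [map_mul] at hl
  simp only [map_sum, map_mul, hl, aeval_X, Sum.elim_inr, Finset.smul_sum, hI, smul_eq_C_mul]
  refine Finset.sum_congr rfl fun i _ => Finset.sum_congr rfl fun j _ => ?_
  ring

/-- On the quadratic symbol `H = g^{ij} ξᵢ ξⱼ`, the universal projectively equivariant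
quantization formula `σ⁻¹(Σ_m C_m(E) D^m (I_ℏ H))` — where `C_m(E)` acts on the
ξ-homogeneous component of degree `k` as the scalar `C_m(k + n/2)`, and `D^m(I_ℏ H)`
is ξ-homogeneous of degree `2 − m` — equals the operator
`−ℏ²(g^{ij}∂ᵢ∂ⱼ + (∂ⱼg^{ij})∂ᵢ + ((n+1)/(4(n+2)))(∂ᵢ∂ⱼg^{ij}))`; equivalently
(applying the normal-ordering bijection `σ`) the two normal symbols agree.
The sum is finite: `D^m(I_ℏ H) = 0` for `m ≥ 3`. -/
theorem stmt12 (n : ℕ) (hn : 1 ≤ n) (ℏ : ℝ)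
    (g : Fin n → Fin n → MvPolynomial (Fin n) ℝ) (hsym : ∀ i j, g i j = g j i) :
    (∀ m : ℕ, 3 ≤ m →
      Dop^[m] (Ihbar ℏ (∑ i, ∑ j, liftXC (g i j) * X (Sum.inr i) * X (Sum.inr j))) = 0) ∧
    ∑ m ∈ range 3, ((Cc m ((2 - (m : ℝ)) + (n : ℝ) / 2) : ℂ)
        • Dop^[m] (Ihbar ℏ (∑ i, ∑ j, liftXC (g i j) * X (Sum.inr i) * X (Sum.inr j))))
      = (-(ℏ : ℂ) ^ 2)
        • ((∑ i, ∑ j, liftXC (g i j) * X (Sum.inr i) * X (Sum.inr j))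
          + (∑ i, ∑ j, liftXC (pderiv j (g i j)) * X (Sum.inr i))
          + (((n : ℂ) + 1) / (4 * ((n : ℂ) + 2)))
            • (∑ i, ∑ j, liftXC (pderiv i (pderiv j (g i j))))) := by
  have h1 : Dop (∑ i, ∑ j, liftXC (g i j) * X (Sum.inr i) * X (Sum.inr j)) =
      (2 : ℂ) • ∑ i, ∑ j, liftXC (pderiv j (g i j)) * X (Sum.inr i) := by
    simp only [Dop_sum, Dop_lift2, Finset.sum_add_distrib]
    rw [two_smul]
    refine congrArg₂ (fun a b => a + b) rfl ?_
    rw [Finset.sum_comm]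
    refine Finset.sum_congr rfl fun i _ => Finset.sum_congr rfl fun j _ => ?_
    rw [hsym]
  have h2 : Dop (∑ i, ∑ j, liftXC (pderiv j (g i j)) * X (Sum.inr i)) =
      ∑ i, ∑ j, liftXC (pderiv i (pderiv j (g i j))) := by
    simp only [Dop_sum, Dop_lift1]
  have h3 : Dop (∑ i, ∑ j, liftXC (pderiv i (pderiv j (g i j)))) = 0 := by
    simp [Dop_sum, Dop_lift]
  rw [Ihbar_H]
  generalize (∑ i, ∑ j, liftXC (g i j) * X (Sum.inr i) * X (Sum.inr j)) = H at *
  generalize (∑ i, ∑ j, liftXC (pderiv j (g i j)) * X (Sum.inr i)) = K at *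
  generalize (∑ i, ∑ j, liftXC (pderiv i (pderiv j (g i j)))) = L at *
  constructor
  · intro m hm
    obtain ⟨k, rfl⟩ := Nat.exists_eq_add_of_le' hm
    rw [Function.iterate_add_apply]
    have : Dop^[3] ((-(ℏ : ℂ) ^ 2) • H) = 0 := by
      simp only [Function.iterate_succ, Function.iterate_zero, Function.comp_apply, id_eq,
        Dop_smul, h1, h2, h3, smul_zero]
    rw [this]
    exact Function.iterate_fixed Dop_zero k
  · have c0 : Cc 0 ((2 - ((0 : ℕ) : ℝ)) + (n : ℝ) / 2) = 1 := by simp [Cc]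
    have c1 : Cc 1 ((2 - ((1 : ℕ) : ℝ)) + (n : ℝ) / 2) = 1 / 2 := by
      have : (n : ℝ) + 3 ≠ 0 := by positivity
      simp only [Cc, Finset.prod_range_succ, Finset.prod_range_zero, Nat.factorial]
      push_cast
      rw [div_eq_iff (by ring_nf; positivity)]
      ring
    have c2 : Cc 2 ((2 - ((2 : ℕ) : ℝ)) + (n : ℝ) / 2) = (n + 1) / (8 * (n + 2)) := by
      simp only [Cc, Finset.prod_range_succ, Finset.prod_range_zero, Nat.factorial]
      push_cast
      rw [div_eq_div_iff (by ring_nf; positivity) (by positivity)]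
      ring
    simp only [Finset.sum_range_succ, Finset.sum_range_zero, c0, c1, c2]
    simp only [Function.iterate_succ, Function.iterate_zero, Function.comp_apply, id_eq,
        Dop_smul, h1, h2, smul_add, smul_smul]
    have hn2 : (n : ℂ) + 2 ≠ 0 := by exact_mod_cast (by positivity : (n + 2 : ℕ) ≠ 0)
    push_cast
    rw [zero_add]
    congr 1
    · congr 1
      · congr 1
        ring
      · congr 1
        ring
    · congr 1
      field_simp
      ring
end

section
/- Let p, q ≥ 0 with n = p + q ≥ 3, let η = diag(1, …, 1, −1, …, −1) be the flat metric of signature (p, q) on ℝ^n, let ℏ ∈ ℝ, and let F : ℝ^n → ℝ be smooth and positive. Consider the conformally flat metric g_{ij} = F η_{ij}, with inverse g^{ij} = F^{−1} η^{ij}, and let Ǎ be the conformally equivariant quantization of the quadratic symbol H = g^{ij} ξ_i ξ_j at weights λ = μ = 1/2: Ǎ f = −ℏ² ( g^{ij} ∂_i ∂_j f + (∂_j g^{ij}) ∂_i f + (n/(4(n+1))) (∂_i ∂_j g^{ij}) f + (n/(4(n+1)(n+2))) η^{kl} ∂_k ∂_l (η_{ij} g^{ij}) f ). Define the quantum Hamiltonian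 Ĥ on smooth functions by Ĥ f = F^{−n/4} Ǎ (F^{n/4} f). Then Ĥ f = −ℏ² ( Δ_g f − (n²/(4(n−1)(n+2))) R_g f ), where Δ_g f = F^{−n/2} ∂_i ( F^{n/2} g^{ij} ∂_j f ) is the Laplace–Beltrami operator of g and R_g = F^{−1} η^{ij} ( −(n−1) ∂_i ∂_j (log F) − ((n−1)(n−2)/4) ∂_i (log F) ∂_j (log F) ) is the scalar curvature of g. -/
set_option maxHeartbeats 1000000

/-- The `i`-th partial derivative of a function on `ℝⁿ`. -/
noncomputable def pd {n : ℕ} (i : Fin n) (f : (Fin n → ℝ) → ℝ) : (Fin n → ℝ) → ℝ :=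
  fun x => fderiv ℝ f x (Pi.single i 1)

/-- The flat metric `η = diag(1, …, 1, −1, …, −1)` of signature `(p, q)` (diagonal
entries; indices are raised and lowered with the same signs). -/
def etaSgn (p q : ℕ) : Fin (p + q) → ℝ := fun i => if (i : ℕ) < p then 1 else -1

/-- The inverse metric `g^{ij} = F⁻¹ η^{ij}` of the conformally flat metric
`g = F η`. -/
noncomputable def gInv (p q : ℕ) (F : (Fin (p + q) → ℝ) → ℝ) :
    Fin (p + q) → Fin (p + q) → (Fin (p + q) → ℝ) → ℝ :=
  fun i j x => (F x)⁻¹ * (if i = j then etaSgn p q i else 0)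

/-- The conformally equivariant quantization at weights `λ = μ = 1/2` of the
quadratic symbol `g^{ij}ξᵢξⱼ`:
`Ǎ f = −ℏ²(g^{ij}∂ᵢ∂ⱼf + (∂ⱼg^{ij})∂ᵢf + (n/(4(n+1)))(∂ᵢ∂ⱼg^{ij})f
 + (n/(4(n+1)(n+2))) η^{kl}∂_k∂_l(η_{ij}g^{ij}) f)`. -/
noncomputable def Acheck (p q : ℕ) (ℏ : ℝ) (F : (Fin (p + q) → ℝ) → ℝ)
    (f : (Fin (p + q) → ℝ) → ℝ) : (Fin (p + q) → ℝ) → ℝ :=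
  fun x => -ℏ ^ 2 * ((∑ i, ∑ j, gInv p q F i j x * pd i (pd j f) x)
    + (∑ i, ∑ j, pd j (gInv p q F i j) x * pd i f x)
    + (((p + q : ℕ) : ℝ) / (4 * ((p + q : ℕ) + 1)))
        * (∑ i, ∑ j, pd i (pd j (gInv p q F i j)) x) * f x
    + (((p + q : ℕ) : ℝ) / (4 * ((p + q : ℕ) + 1) * ((p + q : ℕ) + 2)))
        * (∑ k, etaSgn p q k
            * pd k (pd k (fun y => ∑ i, etaSgn p q i * gInv p q F i i y)) x) * f x)

/-- The quantum Hamiltonian `Ĥ f = F^{−n/4} Ǎ(F^{n/4} f)`, obtained from `Ǎ` by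
conjugation with the identification of half-densities with functions. -/
noncomputable def Hhat (p q : ℕ) (ℏ : ℝ) (F : (Fin (p + q) → ℝ) → ℝ)
    (f : (Fin (p + q) → ℝ) → ℝ) : (Fin (p + q) → ℝ) → ℝ :=
  fun x => (F x) ^ (-((p + q : ℕ) : ℝ) / 4)
    * Acheck p q ℏ F (fun y => (F y) ^ (((p + q : ℕ) : ℝ) / 4) * f y) x

/-- The Laplace–Beltrami operator of `g = F η`:
`Δ_g f = F^{−n/2} ∂ᵢ(F^{n/2} g^{ij} ∂ⱼ f)`. -/
noncomputable def lapBel (p q : ℕ) (F : (Fin (p + q) → ℝ) → ℝ)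
    (f : (Fin (p + q) → ℝ) → ℝ) : (Fin (p + q) → ℝ) → ℝ :=
  fun x => (F x) ^ (-((p + q : ℕ) : ℝ) / 2)
    * ∑ i, pd i (fun y => (F y) ^ (((p + q : ℕ) : ℝ) / 2)
        * ∑ j, gInv p q F i j y * pd j f y) x

/-- The scalar curvature of the conformally flat metric `g = F η`:
`R_g = F⁻¹ η^{ij}(−(n−1)∂ᵢ∂ⱼ(log F) − ((n−1)(n−2)/4)∂ᵢ(log F)∂ⱼ(log F))`. -/
noncomputable def scalCurv (p q : ℕ) (F : (Fin (p + q) → ℝ) → ℝ) :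
    (Fin (p + q) → ℝ) → ℝ :=
  fun x => (F x)⁻¹ * ∑ i, etaSgn p q i
    * (-(((p + q : ℕ) : ℝ) - 1) * pd i (pd i (fun y => Real.log (F y))) x
      - ((((p + q : ℕ) : ℝ) - 1) * (((p + q : ℕ) : ℝ) - 2) / 4)
          * pd i (fun y => Real.log (F y)) x * pd i (fun y => Real.log (F y)) x)

theorem pd_smooth {n : ℕ} (i : Fin n) {f : (Fin n → ℝ) → ℝ}
    (hf : ContDiff ℝ (⊤ : ℕ∞) f) : ContDiff ℝ (⊤ : ℕ∞) (pd i f) := by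
  unfold pd
  exact (hf.fderiv_right (m := (⊤ : ℕ∞)) (by simp)).clm_apply contDiff_const

theorem pd_expmul {n : ℕ} (i : Fin n) (a : ℝ) {L v : (Fin n → ℝ) → ℝ}
    (hL : ContDiff ℝ (⊤ : ℕ∞) L) (hv : ContDiff ℝ (⊤ : ℕ∞) v) :
    pd i (fun y => Real.exp (a * L y) * v y)
      = fun y => Real.exp (a * L y) * (a * pd i L y * v y + pd i v y) := by
  funext y
  have h1 : HasFDerivAt L (fderiv ℝ L y) y :=
    (hL.differentiable (by simp)).differentiableAt.hasFDerivAt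
  have h2 : HasFDerivAt v (fderiv ℝ v y) y :=
    (hv.differentiable (by simp)).differentiableAt.hasFDerivAt
  have h3 := ((h1.const_mul a).exp).mul h2
  unfold pd
  have h4 : fderiv ℝ (fun y => Real.exp (a * L y) * v y) y = _ := h3.fderiv
  rw [h4]
  simp
  ring

theorem pd_const {n : ℕ} (i : Fin n) (c : ℝ) : pd i (fun _ => c) = fun _ => 0 := by
  funext y
  simp [pd]

theorem pd_add' {n : ℕ} (i : Fin n) {u v : (Fin n → ℝ) → ℝ}
    (hu : ContDiff ℝ (⊤ : ℕ∞) u) (hv : ContDiff ℝ (⊤ : ℕ∞) v) :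
    pd i (fun y => u y + v y) = fun y => pd i u y + pd i v y := by
  funext y
  have h1 := (hu.differentiable (by simp)).differentiableAt (x := y)
  have h2 := (hv.differentiable (by simp)).differentiableAt (x := y)
  simp [pd, fderiv_fun_add h1 h2]

theorem pd_mul' {n : ℕ} (i : Fin n) {u v : (Fin n → ℝ) → ℝ}
    (hu : ContDiff ℝ (⊤ : ℕ∞) u) (hv : ContDiff ℝ (⊤ : ℕ∞) v) :
    pd i (fun y => u y * v y) = fun y => pd i u y * v y + u y * pd i v y := by
  funext y
  have h1 := (hu.differentiable (by simp)).differentiableAt (x := y)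
  have h2 := (hv.differentiable (by simp)).differentiableAt (x := y)
  simp [pd, fderiv_fun_mul h1 h2]
  ring

theorem pd_expmul2 {n : ℕ} (i : Fin n) (a : ℝ) {L v : (Fin n → ℝ) → ℝ}
    (hL : ContDiff ℝ (⊤ : ℕ∞) L) (hv : ContDiff ℝ (⊤ : ℕ∞) v) :
    pd i (pd i (fun y => Real.exp (a * L y) * v y))
      = fun y => Real.exp (a * L y) * (a ^ 2 * pd i L y ^ 2 * v y
        + a * pd i (pd i L) y * v y + 2 * a * pd i L y * pd i v y + pd i (pd i v) y) := by
  have hLi := pd_smooth i hL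
  have hvi := pd_smooth i hv
  rw [pd_expmul i a hL hv, pd_expmul i a hL
    (((contDiff_const.mul hLi).mul hv).add hvi),
    pd_add' i ((contDiff_const.mul hLi).mul hv) hvi,
    pd_mul' i (contDiff_const.mul hLi) hv, pd_mul' i contDiff_const hLi, pd_const]
  funext y
  ring

theorem etaSgn_sq (p q : ℕ) (i : Fin (p + q)) : etaSgn p q i * etaSgn p q i = 1 := by
  unfold etaSgn
  split_ifs <;> norm_num

/-- Quantization of the geodesic flow of a conformally flat metric `g = F η`
(`n = p + q ≥ 3`): the quantum Hamiltonian obtained from the conformally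
equivariant quantization of `H = g^{ij}ξᵢξⱼ` at weights `λ = μ = 1/2` is
`Ĥ = −ℏ²(Δ_g − (n²/(4(n−1)(n+2))) R_g)`. -/
theorem stmt13 (p q : ℕ) (hn : 3 ≤ p + q) (ℏ : ℝ)
    (F : (Fin (p + q) → ℝ) → ℝ) (hF : ContDiff ℝ (⊤ : ℕ∞) F) (hFpos : ∀ x, 0 < F x)
    (f : (Fin (p + q) → ℝ) → ℝ) (hf : ContDiff ℝ (⊤ : ℕ∞) f) (x : Fin (p + q) → ℝ) :
    Hhat p q ℏ F f x
      = -ℏ ^ 2 * (lapBel p q F f x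
        - (((p + q : ℕ) : ℝ) ^ 2 / (4 * (((p + q : ℕ) : ℝ) - 1) * (((p + q : ℕ) : ℝ) + 2)))
            * scalCurv p q F x * f x) := by
  obtain ⟨L, hLdef⟩ : ∃ L : (Fin (p + q) → ℝ) → ℝ, L = fun y => Real.log (F y) := ⟨_, rfl⟩
  have hL : ContDiff ℝ (⊤ : ℕ∞) L := hLdef ▸ hF.log (fun y => (hFpos y).ne')
  have hFL : F = fun y => Real.exp (L y) := by
    funext y
    rw [hLdef]
    exact (Real.exp_log (hFpos y)).symm
  clear hLdef hF hFpos
  subst hFL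
  have hn3 : (3 : ℝ) ≤ ((p + q : ℕ) : ℝ) := by exact_mod_cast hn
  have htr : ∀ y, (∑ i, etaSgn p q i * gInv p q (fun y => Real.exp (L y)) i i y)
      = Real.exp (-1 * L y) * ((p + q : ℕ) : ℝ) := by
    intro y
    have : ∀ i, etaSgn p q i * gInv p q (fun y => Real.exp (L y)) i i y
        = Real.exp (-1 * L y) := by
      intro i
      simp only [gInv, if_true, ← Real.exp_neg, neg_one_mul]
      linear_combination Real.exp (-L y) * etaSgn_sq p q i
    simp only [this]
    simp [mul_comm]
  have hg : ∀ i j, gInv p q (fun y => Real.exp (L y)) i j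
      = fun y => Real.exp (-1 * L y) * (if i = j then etaSgn p q i else 0) := by
    intro i j
    funext y
    simp only [gInv, ← Real.exp_neg, neg_one_mul]
  have hpow : ∀ y (a : ℝ), (Real.exp (L y)) ^ a = Real.exp (a * L y) := by
    intro y a
    rw [← Real.exp_mul, mul_comm]
  have hpd0 : ∀ i j : Fin (p + q), ∀ y, pd j (fun y => Real.exp (-1 * L y) * (if i = j then etaSgn p q i else 0)) y
      = if i = j then Real.exp (-1 * L y) * (-1 * pd i L y * etaSgn p q i) else 0 := by
    intro i j y
    rw [pd_expmul j (-1) hL contDiff_const, pd_const]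
    by_cases h : i = j
    · subst h; simp
    · simp [h]
  have hpd1 : ∀ i j : Fin (p + q), pd i (pd j (fun y => Real.exp (-1 * L y) * (if i = j then etaSgn p q i else 0))) x
      = if i = j then Real.exp (-1 * L x) * ((pd i L x ^ 2 - pd i (pd i L) x) * etaSgn p q i) else 0 := by
    intro i j
    by_cases h : i = j
    · subst h
      simp only [if_true]
      rw [pd_expmul2 i (-1) hL contDiff_const, pd_const, pd_const]
      ring
    · simp only [h, if_false, mul_zero, pd_const]
  unfold Hhat Acheck lapBel scalCurv
  simp only [htr]
  simp only [hg, hpow, hpd0, hpd1, Real.log_exp, ← Real.exp_neg]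
  simp only [ite_mul, mul_ite, mul_zero, zero_mul, Finset.sum_ite_eq, Finset.mem_univ, if_true]
  set n : ℝ := ((p + q : ℕ) : ℝ) with hndef
  have hlap : ∀ i, pd i (fun y => Real.exp (n / 2 * L y) *
        (Real.exp (-1 * L y) * etaSgn p q i * pd i f y)) x
      = Real.exp (n / 2 * L x) * (Real.exp (-1 * L x) * (etaSgn p q i *
        ((n / 2 - 1) * pd i L x * pd i f x + pd i (pd i f) x))) := by
    intro i
    have e : (fun y => Real.exp (n / 2 * L y) *
        (Real.exp (-1 * L y) * etaSgn p q i * pd i f y))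
        = fun y => Real.exp ((n / 2 - 1) * L y) * (etaSgn p q i * pd i f y) := by
      funext y
      rw [show (n / 2 - 1) * L y = n / 2 * L y + -1 * L y by ring, Real.exp_add]
      ring
    rw [e, pd_expmul i _ hL (contDiff_const.mul (pd_smooth i hf)),
      pd_mul' i contDiff_const (pd_smooth i hf), pd_const]
    beta_reduce
    rw [show (n / 2 - 1) * L x = n / 2 * L x + -1 * L x by ring, Real.exp_add]
    ring
  simp only [hlap, pd_expmul2 _ _ hL hf, pd_expmul2 _ _ hL contDiff_const, pd_const]
  simp only [pd_expmul _ _ hL hf]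
  have hA : Real.exp (-n / 4 * L x) * Real.exp (n / 4 * L x) = 1 := by
    rw [← Real.exp_add]; ring_nf; simp
  have hB : Real.exp (-n / 2 * L x) * Real.exp (n / 2 * L x) = 1 := by
    rw [← Real.exp_add]; ring_nf; simp
  rw [show -L x = -1 * L x by ring]
  generalize Real.exp (-n / 4 * L x) = A at *
  generalize Real.exp (n / 4 * L x) = A' at *
  generalize Real.exp (-n / 2 * L x) = B at *
  generalize Real.exp (n / 2 * L x) = B' at *
  generalize Real.exp (-1 * L x) = G at *
  have key : ∀ i, (A * A') * (G * etaSgn p q i * (( (n / 4) ^ 2 * pd i L x ^ 2 * f x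
        + n / 4 * pd i (pd i L) x * f x + 2 * (n / 4) * pd i L x * pd i f x + pd i (pd i f) x))
      + G * (-1 * pd i L x * etaSgn p q i) * (n / 4 * pd i L x * f x + pd i f x)
      + n / (4 * (n + 1)) * (G * ((pd i L x ^ 2 - pd i (pd i L) x) * etaSgn p q i)) * f x
      + n / (4 * (n + 1) * (n + 2)) * (etaSgn p q i * (G * ((pd i L x ^ 2 - pd i (pd i L) x) * n))) * f x)
      = (B * B') * (G * (etaSgn p q i *
        ((n / 2 - 1) * pd i L x * pd i f x + pd i (pd i f) x)))
      - n ^ 2 / (4 * (n - 1) * (n + 2)) * (G * (etaSgn p q i *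
        (-(n - 1) * pd i (pd i L) x - (n - 1) * (n - 2) / 4 * pd i L x * pd i L x))) * f x := by
    intro i
    rw [hA, hB]
    have h1 : n - 1 ≠ 0 := by linarith
    have h2 : n + 1 ≠ 0 := by linarith
    have h3 : n + 2 ≠ 0 := by linarith
    field_simp
    ring
  have hs := Finset.sum_congr (rfl : (Finset.univ : Finset (Fin (p + q))) = Finset.univ)
    (fun i _ => congrArg (fun t => -ℏ ^ 2 * t) (key i))
  simp only [Finset.mul_sum, Finset.sum_mul, ← Finset.sum_add_distrib, ← Finset.sum_sub_distrib]
  refine Eq.trans ?_ (hs.trans ?_)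
  · refine Finset.sum_congr rfl fun i _ => ?_
    ring
  · refine Finset.sum_congr rfl fun i _ => ?_
    ring
end
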